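/- Let R be a quasi-local coherent Gorenstein ring with depth R = 0. Then for every x, y ∈ R with (x) ∩ (y) = (0), either x = 0 or y = 0; i.e., the zero ideal is irreducible. -/

import Mathlib

open CategoryTheory Opposite TensorProduct

universe u

namespace AB

/-- `M` is `(FP)ₙ`: there is an exact sequence `Fₙ → ⋯ → F₀ → M → 0`
with each `Fᵢ` finitely generated free.  Equivalently (the form used here),
`(FP)₀` means finitely generated, and `M` is `(FP)_{n+1}` iff there is a
surjection from a finitely generated free module whose kernel is `(FP)ₙ`. -/
def IsFP (R : Type u) [CommRing R] : ℕ → ModuleCat.{u} R → Prop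
  | 0, M => Module.Finite R M
  | n + 1, M => ∃ (k : ℕ) (f : (Fin k → R) →ₗ[R] M), Function.Surjective f ∧
      IsFP R n (ModuleCat.of R (LinearMap.ker f))

/-- `M` is `(FP)_∞`. -/
def IsFPInf (R : Type u) [CommRing R] (M : ModuleCat.{u} R) : Prop := ∀ n, IsFP R n M

/-- `Ext^i_R(M, N)` as a type. -/
noncomputable abbrev ext (R : Type u) [CommRing R] (M N : ModuleCat.{u} R) (i : ℕ) :=
  ((Ext R (ModuleCat.{u} R) i).obj (op M)).obj N

/-- `Ext^i_R(M, N) = 0`. -/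
def extZero (R : Type u) [CommRing R] (M N : ModuleCat.{u} R) (i : ℕ) : Prop :=
  Subsingleton (ext R M N i)

/-- membership in the G-class `G(R)`. -/
def MemG (R : Type u) [CommRing R] (M : ModuleCat.{u} R) : Prop :=
  Module.Finite R M ∧ Module.IsReflexive R M ∧
    (∀ i > 0, extZero R M (ModuleCat.of R R) i) ∧
    (∀ i > 0, extZero R (ModuleCat.of R (Module.Dual R M)) (ModuleCat.of R R) i)

/-- membership in the restricted G-class `G̃(R)`. -/
def MemGtilde (R : Type u) [CommRing R] (M : ModuleCat.{u} R) : Prop :=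
  MemG R M ∧ IsFPInf R M ∧ IsFPInf R (ModuleCat.of R (Module.Dual R M))

/-- `Gdim_R M ≤ n`. -/
def GDimLe (R : Type u) [CommRing R] : ℕ → ModuleCat.{u} R → Prop
  | 0, M => MemG R M
  | n + 1, M => ∃ (G : ModuleCat.{u} R) (f : G →ₗ[R] M), MemG R G ∧ Function.Surjective f ∧
      GDimLe R n (ModuleCat.of R (LinearMap.ker f))

/-- `G̃dim_R M ≤ n`. -/
def GtildeDimLe (R : Type u) [CommRing R] : ℕ → ModuleCat.{u} R → Prop
  | 0, M => MemGtilde R M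
  | n + 1, M => ∃ (G : ModuleCat.{u} R) (f : G →ₗ[R] M), MemGtilde R G ∧ Function.Surjective f ∧
      GtildeDimLe R n (ModuleCat.of R (LinearMap.ker f))

/-- `pd_R M ≤ n`. -/
def ProjDimLe (R : Type u) [CommRing R] : ℕ → ModuleCat.{u} R → Prop
  | 0, M => Module.Projective R M
  | n + 1, M => ∃ (P : ModuleCat.{u} R) (f : P →ₗ[R] M), Module.Projective R P ∧
      Function.Surjective f ∧ ProjDimLe R n (ModuleCat.of R (LinearMap.ker f))

/-- The G-dimension of `M`, as an element of `ℕ∞` (`⊤` meaning `Gdim` is infinite/undefined). -/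
noncomputable def GDim (R : Type u) [CommRing R] (M : ModuleCat.{u} R) : ℕ∞ :=
  sInf {n : ℕ∞ | ∃ m : ℕ, n = m ∧ GDimLe R m M}

/-- The restricted G-dimension of `M`, as an element of `ℕ∞`. -/
noncomputable def GtildeDim (R : Type u) [CommRing R] (M : ModuleCat.{u} R) : ℕ∞ :=
  sInf {n : ℕ∞ | ∃ m : ℕ, n = m ∧ GtildeDimLe R m M}

/-- The projective dimension of `M`, as an element of `ℕ∞`. -/
noncomputable def ProjDim (R : Type u) [CommRing R] (M : ModuleCat.{u} R) : ℕ∞ :=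
  sInf {n : ℕ∞ | ∃ m : ℕ, n = m ∧ ProjDimLe R m M}

/-- The classical depth of `N` with respect to the ideal `I`: the supremum of the
lengths of regular sequences on `N` contained in `I`. -/
noncomputable def cdepth (S : Type u) [CommRing S] (I : Ideal S) (N : Type u)
    [AddCommGroup N] [Module S N] : ℕ∞ :=
  ⨆ rs : {l : List S // (∀ r ∈ l, r ∈ I) ∧ RingTheory.Sequence.IsRegular N l},
    (rs.1.length : ℕ∞)

/-- A bundled faithfully flat (commutative) algebra extension of `R`. -/
structure FFExt (R : Type u) [CommRing R] where
  S : Type u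
  [ring : CommRing S]
  [alg : Algebra R S]
  faithfullyFlat : Module.FaithfullyFlat R S

attribute [instance] FFExt.ring FFExt.alg

/-- The depth of a module `M` over a quasi-local ring `R`: the supremum, over all
faithfully flat extensions `S` of `R`, of the classical depth of `M ⊗_R S` with
respect to `mS`. -/
noncomputable def depth (R : Type u) [CommRing R] [IsLocalRing R] (M : Type u)
    [AddCommGroup M] [Module R M] : ℕ∞ :=
  ⨆ E : FFExt R,
    cdepth E.S (Ideal.map (algebraMap R E.S) (IsLocalRing.maximalIdeal R))
      (TensorProduct R E.S M)

end AB

namespace AB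

open Abelian

/-- `Ext^i_R(M, R) = 0` for all `i > 0`, in terms of `CategoryTheory.Abelian.Ext`. -/
def DualAcyclic (R : Type u) [CommRing R] (M : Type u) [AddCommGroup M] [Module R M] : Prop :=
  ∀ i > 0, Subsingleton (Abelian.Ext (ModuleCat.of R M) (ModuleCat.of R R) i)

section Ext

variable {R : Type u} [CommRing R]

lemma subsingleton_ext_of_extZero {M N : ModuleCat.{u} R} {i : ℕ} (hi : 0 < i)
    (h : extZero R M N i) : Subsingleton (Abelian.Ext M N i) := by
  obtain ⟨p, rfl⟩ : ∃ p, i = p + 1 := ⟨i - 1, by omega⟩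
  let P := projectiveResolution M
  refine subsingleton_of_forall_eq 0 fun α ↦ ?_
  obtain ⟨f, hf, rfl⟩ := P.extMk_surjective α (p + 2) rfl
  rw [P.extMk_eq_zero_iff f (p + 2) rfl hf p rfl]
  have hz : Limits.IsZero ((P.complex.linearYonedaObj R N).homology (p + 1)) :=
    (ModuleCat.isZero_of_iff_subsingleton.mpr h : Limits.IsZero (ext R M N (p + 1))).of_iso
      (P.isoExt (p + 1) N).symm
  rw [← HomologicalComplex.exactAt_iff_isZero_homology,
    HomologicalComplex.exactAt_iff' _ p (p + 1) (p + 2) (by simp) (by simp),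
    ShortComplex.moduleCat_exact_iff] at hz
  obtain ⟨g, hg⟩ := hz f hf
  exact ⟨g, hg⟩

variable {K G M : Type u} [AddCommGroup K] [Module R K] [AddCommGroup G] [Module R G]
  [AddCommGroup M] [Module R M]

lemma dualAcyclic_of_projective [Module.Projective R M] : DualAcyclic R M := by
  intro i hi
  obtain ⟨p, rfl⟩ : ∃ p, i = p + 1 := ⟨i - 1, by omega⟩
  have : Projective (ModuleCat.of R M) := (IsProjective.iff_projective _).mp inferInstance
  exact Ext.subsingleton_of_projective _ _ _

section Exact

variable {f : K →ₗ[R] G} {g : G →ₗ[R] M} (hf : Function.Injective f) (hfg : Function.Exact f g)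
  (hg : Function.Surjective g)

/-- The short complex attached to an exact sequence of linear maps. -/
abbrev shortCx (hfg : Function.Exact f g) : ShortComplex (ModuleCat.{u} R) :=
  ShortComplex.mk (ModuleCat.ofHom f) (ModuleCat.ofHom g) (by
    ext x; exact hfg.apply_apply_eq_zero x)

include hf hg in
lemma shortCx_shortExact : (shortCx hfg).ShortExact :=
  ModuleCat.shortComplex_shortExact _ hfg hf hg

include hf hfg hg

/-- The middle term of a short exact sequence is acyclic if the outer terms are. -/
lemma DualAcyclic.middle (hK : DualAcyclic R K) (hM : DualAcyclic R M) : DualAcyclic R G := by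
  intro i hi
  have := hK i hi
  have := hM i hi
  refine subsingleton_of_forall_eq 0 fun α ↦ ?_
  obtain ⟨β, rfl⟩ := Ext.contravariant_sequence_exact₂ (shortCx_shortExact hf hfg hg) _ α
    (Subsingleton.elim (α := Abelian.Ext (ModuleCat.of R K) _ i) _ _)
  rw [Subsingleton.elim (α := Abelian.Ext (ModuleCat.of R M) _ i) β 0, Ext.comp_zero]

/-- The left term of a short exact sequence is acyclic if the other terms are. -/
lemma DualAcyclic.left (hG : DualAcyclic R G) (hM : DualAcyclic R M) : DualAcyclic R K := by
  intro i hi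
  have := hG i hi
  have := hM (1 + i) (by omega)
  refine subsingleton_of_forall_eq 0 fun α ↦ ?_
  obtain ⟨β, rfl⟩ := Ext.contravariant_sequence_exact₁ (shortCx_shortExact hf hfg hg) _ α rfl
    (Subsingleton.elim (α := Abelian.Ext (ModuleCat.of R M) _ (1 + i)) _ _)
  rw [Subsingleton.elim (α := Abelian.Ext (ModuleCat.of R G) _ i) β 0, Ext.comp_zero]

/-- The right term of a short exact sequence is acyclic if the other terms are and the dual
sequence is exact. -/
lemma DualAcyclic.right (hK : DualAcyclic R K) (hG : DualAcyclic R G)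
    (hext : Function.Surjective f.dualMap) : DualAcyclic R M := by
  intro i hi
  have := hG i hi
  refine subsingleton_of_forall_eq 0 fun α ↦ ?_
  obtain ⟨p, rfl⟩ : ∃ p, i = 1 + p := ⟨i - 1, by omega⟩
  have hS := shortCx_shortExact hf hfg hg
  obtain ⟨β, rfl⟩ := Ext.contravariant_sequence_exact₃ hS _ α
    (Subsingleton.elim (α := Abelian.Ext (ModuleCat.of R G) _ (1 + p)) _ _) rfl
  rcases p.eq_zero_or_pos with rfl | hp
  · obtain ⟨φ, rfl⟩ := (Ext.mk₀_bijective _ _).surjective β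
    obtain ⟨ψ, hψ⟩ := hext φ.hom
    have : φ = (shortCx hfg).f ≫ ModuleCat.ofHom ψ := by
      ext x; exact (LinearMap.congr_fun hψ x).symm
    rw [this, ← Ext.mk₀_comp_mk₀, ← Ext.comp_assoc_of_second_deg_zero, hS.extClass_comp,
      Ext.zero_comp]
  · have := hK p hp
    rw [Subsingleton.elim (α := Abelian.Ext (ModuleCat.of R K) _ p) β 0, Ext.comp_zero]

/-- Functionals extend along an injection with acyclic cokernel. -/
lemma DualAcyclic.dualMap_surjective (hM : DualAcyclic R M) :
    Function.Surjective f.dualMap := by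
  intro φ
  have := hM 1 one_pos
  obtain ⟨β, hβ⟩ := Ext.contravariant_sequence_exact₁ (shortCx_shortExact hf hfg hg) _
    (Ext.mk₀ (ModuleCat.ofHom φ)) (n₁ := 1) rfl
    (Subsingleton.elim (α := Abelian.Ext (ModuleCat.of R M) (ModuleCat.of R R) 1) _ _)
  obtain ⟨ψ, rfl⟩ := (Ext.mk₀_bijective _ _).surjective β
  rw [Ext.mk₀_comp_mk₀] at hβ
  have h := (Ext.mk₀_bijective _ _).injective hβ
  refine ⟨ψ.hom, LinearMap.ext fun x ↦ ?_⟩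
  exact LinearMap.congr_fun (congrArg ModuleCat.Hom.hom h) x

end Exact

end Ext

end AB

section TotallyReflexive

open Module Function

variable {R : Type u} [CommRing R]

namespace AB

/-- Membership in the G-class, phrased with `CategoryTheory.Abelian.Ext`. -/
structure IsTotallyReflexive (R : Type u) [CommRing R] (M : Type u) [AddCommGroup M]
    [Module R M] : Prop where
  finite : Module.Finite R M
  reflexive : IsReflexive R M
  acyclic : DualAcyclic R M
  acyclic_dual : DualAcyclic R (Dual R M)

/-- The G-dimension of `M` is at most `n`, in terms of short exact sequences of linear maps. -/
inductive HasGDimLe (R : Type u) [CommRing R] :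
    ℕ → (M : Type u) → [AddCommGroup M] → [Module R M] → Prop
  | zero {M : Type u} [AddCommGroup M] [Module R M] (h : IsTotallyReflexive R M) :
      HasGDimLe R 0 M
  | succ {n : ℕ} {K G M : Type u} [AddCommGroup K] [Module R K] [AddCommGroup G] [Module R G]
      [AddCommGroup M] [Module R M] (i : K →ₗ[R] G) (p : G →ₗ[R] M) (hi : Injective i)
      (hip : Exact i p) (hp : Surjective p) (hG : IsTotallyReflexive R G)
      (hK : HasGDimLe R n K) : HasGDimLe R (n + 1) M

lemma MemG.isTotallyReflexive {M : ModuleCat.{u} R} (h : MemG R M) : IsTotallyReflexive R M where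
  finite := h.1
  reflexive := h.2.1
  acyclic i hi := subsingleton_ext_of_extZero hi (h.2.2.1 i hi)
  acyclic_dual i hi := subsingleton_ext_of_extZero hi (h.2.2.2 i hi)

lemma GDimLe.hasGDimLe {n : ℕ} {M : ModuleCat.{u} R} (h : GDimLe R n M) : HasGDimLe R n M := by
  induction n generalizing M with
  | zero => exact .zero (MemG.isTotallyReflexive h)
  | succ n ih =>
    obtain ⟨G, f, hG, hf, hK⟩ := h
    exact .succ (LinearMap.ker f).subtype f (Submodule.injective_subtype _)
      (LinearMap.exact_subtype_ker_map f) hf hG.isTotallyReflexive (ih hK)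

variable {K G M N : Type u} [AddCommGroup K] [Module R K] [AddCommGroup G] [Module R G]
  [AddCommGroup M] [Module R M] [AddCommGroup N] [Module R N]

lemma exists_hasGDimLe_of_GDim_ne_top (h : GDim R (ModuleCat.of R M) ≠ ⊤) :
    ∃ n, HasGDimLe R n M := by
  by_contra! hn
  refine h (sInf_eq_top.mpr ?_)
  rintro _ ⟨m, rfl, hm⟩
  exact (hn m hm.hasGDimLe).elim

lemma HasGDimLe.finite {n : ℕ} (h : HasGDimLe R n M) : Module.Finite R M := by
  cases h with
  | zero h => exact h.finite
  | succ i p hi hip hp hG hK => exact have := hG.finite; .of_surjective p hp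

lemma isTotallyReflexive_of_projective [Module.Finite R M] [Projective R M] :
    IsTotallyReflexive R M :=
  ⟨inferInstance, inferInstance, dualAcyclic_of_projective, dualAcyclic_of_projective⟩

lemma exact_dualMap {K G M : Type*} [AddCommGroup K] [Module R K] [AddCommGroup G] [Module R G]
    [AddCommGroup M] [Module R M] {f : K →ₗ[R] G} {g : G →ₗ[R] M} (hfg : Exact f g)
    (hg : Surjective g) :
    Exact g.dualMap f.dualMap := by
  intro φ
  constructor
  · intro h
    have hle : LinearMap.ker g ≤ LinearMap.ker φ := by
      intro x hx
      obtain ⟨k, rfl⟩ := (hfg x).mp hx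
      exact LinearMap.congr_fun h k
    refine ⟨(LinearMap.ker g).liftQ φ hle ∘ₗ (g.quotKerEquivOfSurjective hg).symm.toLinearMap,
      LinearMap.ext fun x ↦ ?_⟩
    have : (g.quotKerEquivOfSurjective hg).symm (g x) = Submodule.Quotient.mk x := by
      rw [LinearEquiv.symm_apply_eq]; rfl
    simp [this]
  · rintro ⟨ψ, rfl⟩
    ext k
    simp [hfg.apply_apply_eq_zero]

lemma IsTotallyReflexive.prod (hM : IsTotallyReflexive R M) (hN : IsTotallyReflexive R N) :
    IsTotallyReflexive R (M × N) where
  finite := have := hM.finite; have := hN.finite; inferInstance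
  reflexive := have := hM.reflexive; have := hN.reflexive; inferInstance
  acyclic := .middle LinearMap.inl_injective .inl_snd
    LinearMap.snd_surjective hM.acyclic hN.acyclic
  acyclic_dual := by
    refine .middle (LinearMap.dualMap_injective_of_surjective LinearMap.snd_surjective)
      (exact_dualMap (f := LinearMap.inl R M N) .inl_snd LinearMap.snd_surjective)
      (fun φ ↦ ⟨φ ∘ₗ LinearMap.fst R M N, ?_⟩) hN.acyclic_dual hM.acyclic_dual
    ext; simp

lemma HasGDimLe.prod {n : ℕ} (hM : HasGDimLe R n M) (hN : IsTotallyReflexive R N) :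
    HasGDimLe R n (M × N) := by
  cases hM with
  | zero h => exact .zero (h.prod hN)
  | succ i p hi hip hp hG hK =>
    refine .succ (LinearMap.inl R _ N ∘ₗ i) (p.prodMap .id) (LinearMap.inl_injective.comp hi) ?_
      (hp.prodMap surjective_id) (hG.prod hN) hK
    rintro ⟨x, y⟩
    constructor
    · intro h
      obtain ⟨hx, hy⟩ := Prod.mk.inj h
      obtain ⟨k, rfl⟩ := (hip x).mp hx
      exact ⟨k, Prod.ext rfl hy.symm⟩
    · rintro ⟨k, hk⟩
      obtain ⟨rfl, rfl⟩ := Prod.mk.inj hk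
      simp [hip.apply_apply_eq_zero]

/-- The kernel of a surjection between totally reflexive modules is totally reflexive as soon as
it is finitely generated. -/
lemma IsTotallyReflexive.left {i : K →ₗ[R] G} {p : G →ₗ[R] M} (hi : Injective i)
    (hip : Exact i p) (hp : Surjective p) (hG : IsTotallyReflexive R G)
    (hM : IsTotallyReflexive R M) [Module.Finite R K] : IsTotallyReflexive R K := by
  have hGr := hG.reflexive
  have hMr := hM.reflexive
  have hi' : Surjective i.dualMap := hM.acyclic.dualMap_surjective hi hip hp
  refine ⟨inferInstance, ⟨?_, ?_⟩, .left hi hip hp hG.acyclic hM.acyclic,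
    .right (LinearMap.dualMap_injective_of_surjective hp) (exact_dualMap hip hp) hi'
      hM.acyclic_dual hG.acyclic_dual ?_⟩
  · rw [injective_iff_map_eq_zero]
    intro x hx
    refine hi ?_
    rw [map_zero, ← (bijective_dual_eval R G).injective.eq_iff, map_zero]
    ext φ
    exact LinearMap.congr_fun hx (φ ∘ₗ i)
  · intro θ
    obtain ⟨x, hx⟩ := (bijective_dual_eval R G).surjective (θ ∘ₗ i.dualMap)
    have hpx : p x = 0 := by
      rw [← (bijective_dual_eval R M).injective.eq_iff, map_zero]
      ext γ
      have h := LinearMap.congr_fun hx (γ ∘ₗ p)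
      have h0 : i.dualMap (γ ∘ₗ p) = 0 := by ext k; simp [hip.apply_apply_eq_zero]
      simpa [h0] using h
    obtain ⟨l, rfl⟩ := (hip x).mp hpx
    refine ⟨l, LinearMap.ext fun φ ↦ ?_⟩
    obtain ⟨ψ, rfl⟩ := hi' φ
    exact LinearMap.congr_fun hx ψ
  · intro θ
    obtain ⟨m, rfl⟩ := (bijective_dual_eval R M).surjective θ
    obtain ⟨x, rfl⟩ := hp m
    exact ⟨Dual.eval R G x, rfl⟩

/-- The cokernel of an injection between totally reflexive modules is totally reflexive if the
dual map is surjective. -/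
lemma IsTotallyReflexive.right {i : K →ₗ[R] G} {p : G →ₗ[R] M} (hi : Injective i)
    (hip : Exact i p) (hp : Surjective p) (hK : IsTotallyReflexive R K)
    (hG : IsTotallyReflexive R G) (hi' : Surjective i.dualMap) : IsTotallyReflexive R M := by
  have hGf := hG.finite
  have hGr := hG.reflexive
  have hKr := hK.reflexive
  have hp' := LinearMap.dualMap_injective_of_surjective hp
  refine ⟨.of_surjective p hp, ⟨?_, ?_⟩, .right hi hip hp hK.acyclic hG.acyclic hi',
    .left hp' (exact_dualMap hip hp) hi' hG.acyclic_dual hK.acyclic_dual⟩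
  · rw [injective_iff_map_eq_zero]
    intro m hm
    obtain ⟨x, rfl⟩ := hp m
    obtain ⟨θ, hθ⟩ := (exact_dualMap (exact_dualMap hip hp) hi' (Dual.eval R G x)).mp (by
      ext γ
      exact LinearMap.congr_fun hm γ)
    obtain ⟨l, rfl⟩ := (bijective_dual_eval R K).surjective θ
    have hx : i l = x := (bijective_dual_eval R G).injective hθ
    rw [← hx, hip.apply_apply_eq_zero]
  · intro θ
    obtain ⟨η, rfl⟩ := hK.acyclic_dual.dualMap_surjective hp' (exact_dualMap hip hp) hi' θ
    obtain ⟨x, rfl⟩ := (bijective_dual_eval R G).surjective η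
    exact ⟨p x, rfl⟩

/-- A finitely generated kernel of a surjection onto a totally reflexive module inherits bounds
on the G-dimension. -/
lemma HasGDimLe.left {n : ℕ} {i : K →ₗ[R] G} {p : G →ₗ[R] M} (hi : Injective i)
    (hip : Exact i p) (hp : Surjective p) (hG : HasGDimLe R n G)
    (hM : IsTotallyReflexive R M) [Module.Finite R K] : HasGDimLe R n K := by
  cases hG with
  | zero h => exact .zero (.left hi hip hp h hM)
  | @succ n K' G' _ _ _ _ _ _ _ i' p' hi' hip' hp' hG' hK' =>
    let L := LinearMap.ker (p ∘ₗ p')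
    have hL (x : L) : p' x ∈ LinearMap.range i := (hip _).mp x.2
    let e := LinearEquiv.ofInjective i hi
    let q : L →ₗ[R] K := e.symm.toLinearMap ∘ₗ (p' ∘ₗ L.subtype).codRestrict _ hL
    have hq (x : L) : i (q x) = p' x := by
      have := e.apply_symm_apply ⟨p' x, hL x⟩
      exact congrArg Subtype.val this
    let j : K' →ₗ[R] L := i'.codRestrict L fun k ↦ by
      simp [L, hip'.apply_apply_eq_zero]
    have hq_surj : Surjective q := by
      intro k
      obtain ⟨x, hx⟩ := hp' (i k)
      refine ⟨⟨x, by simp [L, hx, hip.apply_apply_eq_zero]⟩, hi ?_⟩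
      rw [hq, hx]
    have hjq : Exact j q := by
      intro x
      rw [← hi.eq_iff, hq, map_zero, hip' x]
      constructor
      · rintro ⟨k, hk⟩
        exact ⟨k, Subtype.ext hk⟩
      · rintro ⟨k, rfl⟩
        exact ⟨k, rfl⟩
    have hK'f := hK'.finite
    have : Module.Finite R L := by
      refine ⟨Submodule.fg_of_fg_map_of_fg_inf_ker q ?_ ?_⟩
      · rw [Submodule.map_top, LinearMap.range_eq_top.mpr hq_surj]
        exact Module.Finite.fg_top
      · rw [top_inf_eq, hjq.linearMap_ker_eq, ← Submodule.map_top]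
        exact Module.Finite.fg_top.map j
    exact .succ j q (fun a b h ↦ hi' (congrArg Subtype.val h)) hjq hq_surj
      (.left L.subtype_injective (LinearMap.exact_subtype_ker_map _) (hp.comp hp') hG' hM) hK'

/-- A finitely generated syzygy of a module of positive G-dimension has smaller G-dimension. -/
lemma HasGDimLe.syzygy {n : ℕ} (hM : HasGDimLe R (n + 1) M) [Module.Finite R G]
    [Projective R G] {i : K →ₗ[R] G} {p : G →ₗ[R] M} (hi : Injective i) (hip : Exact i p)
    (hp : Surjective p) [Module.Finite R K] : HasGDimLe R n K := by
  cases hM with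
  | @succ _ K' G' _ _ _ _ _ _ _ i' p' hi' hip' hp' hG' hK' =>
  obtain ⟨h, hh⟩ := Module.projective_lifting_property p' p hp'
  have hh' (x : G) : p' (h x) = p x := LinearMap.congr_fun hh x
  have hL (k : K) : -h (i k) ∈ LinearMap.range i' :=
    (hip' _).mp (by simp [hh', hip.apply_apply_eq_zero])
  let e := LinearEquiv.ofInjective i' hi'
  let r : K →ₗ[R] K' := e.symm.toLinearMap ∘ₗ (-(h ∘ₗ i)).codRestrict _ hL
  have hr (k : K) : i' (r k) = -h (i k) :=
    congrArg Subtype.val (e.apply_symm_apply ⟨-h (i k), hL k⟩)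
  have hKG : HasGDimLe R n (K' × G) := hK'.prod isTotallyReflexive_of_projective
  refine hKG.left (i := r.prod i) (p := i'.coprod h) (fun a b hab ↦ hi (Prod.mk.inj hab).2) ?_ ?_
    hG'
  · rintro ⟨k', x⟩
    rw [LinearMap.coprod_apply]
    constructor
    · intro hx
      have : p x = 0 := by
        have := congrArg p' hx
        simpa [hip'.apply_apply_eq_zero, hh'] using this
      obtain ⟨k, rfl⟩ := (hip x).mp this
      refine ⟨k, Prod.ext (hi' ?_) rfl⟩
      change i' (r k) = _
      rw [hr, eq_comm, ← add_eq_zero_iff_eq_neg, hx]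
    · rintro ⟨k, hk⟩
      obtain ⟨rfl, rfl⟩ := Prod.mk.inj hk
      simp [hr]
  · intro g
    obtain ⟨x, hx⟩ := hp (p' g)
    obtain ⟨k, hk⟩ := (hip' (g - h x)).mp (by simp [hh', hx])
    exact ⟨(k, x), by simp [hk]⟩

end AB

end TotallyReflexive

section DepthZero

open Module Function

variable {R : Type u} [CommRing R]

namespace AB

/-- Over a local ring of depth zero, every proper finitely generated ideal has a nonzero
annihilator. -/
lemma exists_ne_zero_of_depth_eq_zero [IsLocalRing R] (hdepth : depth R R = 0) {J : Ideal R}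
    (hJ : J.FG) (hJ' : J ≠ ⊤) : ∃ a : R, a ≠ 0 ∧ ∀ b ∈ J, a * b = 0 := by
  obtain ⟨n, g, rfl⟩ := Submodule.fg_iff_exists_fin_generating_family.mp hJ
  let P : Polynomial R := ∑ i : Fin n, Polynomial.monomial i.val (g i)
  have hcoeff (i : Fin n) : P.coeff i = g i := by
    simp [P, Polynomial.finsetSum_coeff, Polynomial.coeff_monomial, Fin.val_inj]
  suffices hP : P ∉ nonZeroDivisors (Polynomial R) by
    obtain ⟨a, ha, h⟩ := Polynomial.notMem_nonZeroDivisors_iff.mp hP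
    refine ⟨a, ha, fun b hb ↦ ?_⟩
    have hle : Submodule.span R (Set.range g) ≤ LinearMap.ker (LinearMap.mulLeft R a) := by
      rw [Submodule.span_le]
      rintro _ ⟨i, rfl⟩
      have := congrArg (fun Q ↦ Q.coeff (i : ℕ)) h
      simpa [hcoeff] using this
    exact hle hb
  intro hP
  let E : FFExt R := ⟨Polynomial R, inferInstance⟩
  let I := Ideal.map (algebraMap R E.S) (IsLocalRing.maximalIdeal R)
  have hPI : P ∈ I := by
    refine Ideal.sum_mem _ fun i _ ↦ ?_
    rw [← mul_one (g i), ← Polynomial.C_mul_monomial]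
    exact Ideal.mul_mem_right _ _ (Ideal.mem_map_of_mem _ (IsLocalRing.le_maximalIdeal hJ'
      (Submodule.subset_span ⟨i, rfl⟩)))
  have hI : I ≠ ⊤ := by
    intro h
    have : (1 : Polynomial R) ∈ I := h ▸ Submodule.mem_top
    have h1 := (Ideal.mem_map_C_iff (I := IsLocalRing.maximalIdeal R)).mp this 0
    simp at h1
  let e : E.S ⊗[R] R ≃ₗ[E.S] E.S := TensorProduct.AlgebraTensorModule.rid R E.S E.S
  have hreg : RingTheory.Sequence.IsRegular (E.S ⊗[R] R) [(P : E.S)] := by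
    rw [e.isRegular_congr]
    refine ⟨(RingTheory.Sequence.isWeaklyRegular_singleton_iff _ _).mpr fun x y hxy ↦ ?_, ?_⟩
    · exact (mul_cancel_left_mem_nonZeroDivisors hP).mp hxy
    · rw [Ideal.ofList_singleton, smul_eq_mul, Ideal.mul_top]
      intro h
      exact hI (top_le_iff.mp (h ▸ (Ideal.span_singleton_le_iff_mem _).mpr hPI))
  have h1 : (1 : ℕ∞) ≤ depth R R := by
    refine le_trans ?_ (le_iSup (fun E : FFExt R ↦ cdepth E.S
      (Ideal.map (algebraMap R E.S) (IsLocalRing.maximalIdeal R)) (E.S ⊗[R] R)) E)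
    exact le_iSup (fun rs : {l : List E.S // (∀ r ∈ l, r ∈ I) ∧
      RingTheory.Sequence.IsRegular (E.S ⊗[R] R) l} ↦ (rs.1.length : ℕ∞))
      ⟨[(P : E.S)], by simpa using hPI, hreg⟩
  simp [hdepth] at h1

/-- If every proper finitely generated ideal has a nonzero annihilator, a finitely presented module
with zero dual is zero. -/
lemma subsingleton_of_subsingleton_dual
    (hR : ∀ J : Ideal R, J.FG → J ≠ ⊤ → ∃ a : R, a ≠ 0 ∧ ∀ b ∈ J, a * b = 0)
    (E : Type*) [AddCommGroup E] [Module R E] [FinitePresentation R E]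
    (hE : Subsingleton (Dual R E)) : Subsingleton E := by
  classical
  by_contra hne
  obtain ⟨s, hs⟩ := Module.Finite.fg_top (R := R) (M := E)
  have hne' : (⊥ : Submodule R E) ≠ ⊤ := fun h ↦
    hne ((Submodule.subsingleton_iff R).mp (subsingleton_of_bot_eq_top h))
  obtain ⟨t, ht, htmax⟩ := (s.powerset.filter
    fun t : Finset E ↦ Submodule.span R (t : Set E) ≠ ⊤).exists_maximal ⟨∅, by simp [hne']⟩
  simp only [Finset.mem_filter, Finset.mem_powerset] at ht htmax
  set N := Submodule.span R (t : Set E) with hN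
  obtain ⟨x, hxs, hxN⟩ : ∃ x ∈ s, x ∉ N := by
    by_contra! h
    exact ht.2 (top_le_iff.mp (hs ▸ Submodule.span_le.mpr h))
  have htop : Submodule.span R (insert x (t : Set E)) = ⊤ := by
    by_contra h
    have := htmax (y := insert x t) ⟨Finset.insert_subset hxs ht.1, by rwa [Finset.coe_insert]⟩
      (Finset.subset_insert x t)
    exact hxN (Submodule.subset_span (this (Finset.mem_insert_self x t)))
  have hfp : FinitePresentation R (E ⧸ N) :=
    finitePresentation_of_surjective N.mkQ N.mkQ_surjective
      (by rw [Submodule.ker_mkQ]; exact ⟨t, rfl⟩)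
  let f : R →ₗ[R] E ⧸ N := LinearMap.toSpanSingleton R _ (N.mkQ x)
  have hf : Surjective f := by
    intro y
    obtain ⟨y, rfl⟩ := N.mkQ_surjective y
    obtain ⟨a, z, hz, rfl⟩ := Submodule.mem_span_insert.mp (htop ▸ Submodule.mem_top (x := y))
    refine ⟨a, ?_⟩
    have : N.mkQ z = 0 := by simpa using hz
    simp [f, this, -Submodule.mkQ_apply]
  have hJ : LinearMap.ker f ≠ ⊤ := by
    intro h
    have : f 1 = 0 := LinearMap.mem_ker.mp (h ▸ Submodule.mem_top)
    exact hxN (by simpa [f] using this)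
  obtain ⟨a, ha, hab⟩ := hR _ (FinitePresentation.fg_ker f hf) hJ
  let φ : E ⧸ N →ₗ[R] R := (LinearMap.ker f).liftQ (LinearMap.mulLeft R a) hab ∘ₗ
    (f.quotKerEquivOfSurjective hf).symm.toLinearMap
  have hφ : φ (f 1) = a := by
    have : (f.quotKerEquivOfSurjective hf).symm (f 1) = Submodule.Quotient.mk 1 := by
      rw [LinearEquiv.symm_apply_eq]; rfl
    rw [LinearMap.comp_apply, LinearEquiv.coe_coe, this]
    exact mul_one a
  refine ha ?_
  rw [← hφ]
  have := LinearMap.congr_fun (hE.elim (φ ∘ₗ N.mkQ) 0) x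
  simpa [f] using this

end AB

end DepthZero

section Coherent

open Module Function

variable {R : Type u} [CommRing R]

namespace AB

/-- Every finitely generated submodule is finitely presented. -/
def IsPseudoCoherent (R : Type*) [CommRing R] (M : Type*) [AddCommGroup M] [Module R M] : Prop :=
  ∀ N : Submodule R M, N.FG → FinitePresentation R N

lemma IsPseudoCoherent.of_injective {M M' : Type*} [AddCommGroup M] [Module R M]
    [AddCommGroup M'] [Module R M'] (f : M →ₗ[R] M') (hf : Injective f)
    (h : IsPseudoCoherent R M') : IsPseudoCoherent R M := fun N hN ↦
  have := h _ (hN.map f)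
  .of_equiv (N.equivMapOfInjective f hf).symm

lemma IsPseudoCoherent.finitePresentation {M N : Type*} [AddCommGroup M] [Module R M]
    [AddCommGroup N] [Module R N] (h : IsPseudoCoherent R M) (f : N →ₗ[R] M) (hf : Injective f)
    [Module.Finite R N] : FinitePresentation R N :=
  have := h _ (Module.Finite.fg_top.map f)
  .of_equiv ((Submodule.equivMapOfInjective f hf ⊤).symm.trans Submodule.topEquiv)

lemma IsPseudoCoherent.finite_ker {M N : Type*} [AddCommGroup M] [Module R M]
    [AddCommGroup N] [Module R N] (h : IsPseudoCoherent R M) (f : N →ₗ[R] M)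
    [Module.Finite R N] : (LinearMap.ker f).FG := by
  have := h (LinearMap.range f) (by
    rw [← Submodule.map_top]; exact Module.Finite.fg_top.map f)
  rw [← LinearMap.ker_rangeRestrict]
  exact FinitePresentation.fg_ker _ f.surjective_rangeRestrict

lemma IsPseudoCoherent.prod {M M' : Type*} [AddCommGroup M] [Module R M]
    [AddCommGroup M'] [Module R M'] (h : IsPseudoCoherent R M) (h' : IsPseudoCoherent R M') :
    IsPseudoCoherent R (M × M') := by
  intro N hN
  have : Module.Finite R N := .of_fg hN
  let q : N →ₗ[R] M := LinearMap.fst R M M' ∘ₗ N.subtype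
  have hq : FinitePresentation R (LinearMap.range q) := h _ (by
    rw [← Submodule.map_top]; exact Module.Finite.fg_top.map q)
  have : Module.Finite R (LinearMap.ker q.rangeRestrict) :=
    .of_fg (FinitePresentation.fg_ker _ q.surjective_rangeRestrict)
  have : FinitePresentation R (LinearMap.ker q.rangeRestrict) := by
    refine h'.finitePresentation (N := LinearMap.ker q.rangeRestrict)
      (LinearMap.snd R M M' ∘ₗ N.subtype ∘ₗ (LinearMap.ker q.rangeRestrict).subtype) ?_
    rintro ⟨⟨x, hx⟩, hx'⟩ ⟨⟨y, hy⟩, hy'⟩ hxy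
    have hx0 : x.1 = 0 := congrArg Subtype.val hx'
    have hy0 : y.1 = 0 := congrArg Subtype.val hy'
    have : x = y := Prod.ext (hx0.trans hy0.symm) hxy
    subst this
    rfl
  exact finitePresentation_of_ker q.rangeRestrict q.surjective_rangeRestrict

lemma isPseudoCoherent_pi (h : IsPseudoCoherent R R) (n : ℕ) : IsPseudoCoherent R (Fin n → R) := by
  induction n with
  | zero => exact fun N _ ↦ inferInstance
  | succ n ih =>
    exact .of_injective (Fin.consLinearEquiv R (fun _ ↦ R)).symm.toLinearMap
      (LinearEquiv.injective _) (h.prod ih)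

lemma isPseudoCoherent_of_free (h : IsPseudoCoherent R R) (M : Type*) [AddCommGroup M]
    [Module R M] [Module.Finite R M] [Module.Free R M] : IsPseudoCoherent R M :=
  .of_injective ((Module.Free.chooseBasis R M).reindex (Fintype.equivFin _)).equivFun.toLinearMap
    (LinearEquiv.injective _) (isPseudoCoherent_pi h _)

/-- Over a coherent ring, the dual of a finitely presented module is finitely presented. -/
lemma finitePresentation_dual (h : IsPseudoCoherent R R) (M : Type*) [AddCommGroup M]
    [Module R M] [FinitePresentation R M] : FinitePresentation R (Dual R M) := by
  obtain ⟨n, m, f, g, hf, hfg⟩ := FinitePresentation.exists_fin' R M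
  have hf' := LinearMap.dualMap_injective_of_surjective hf
  have hker := (isPseudoCoherent_of_free h (Dual R (Fin m → R))).finite_ker g.dualMap
  rw [(exact_dualMap hfg hf).linearMap_ker_eq] at hker
  have : Module.Finite R (LinearMap.range f.dualMap) := .of_fg hker
  have : Module.Finite R (Dual R M) := .equiv (LinearEquiv.ofInjective _ hf').symm
  exact (isPseudoCoherent_of_free h (Dual R (Fin n → R))).finitePresentation _ hf'

end AB

end Coherent

section Gorenstein

open Module Function

namespace AB

variable {R : Type u} [CommRing R] (hcoh : IsPseudoCoherent R R)
  (hR : ∀ J : Ideal R, J.FG → J ≠ ⊤ → ∃ a : R, a ≠ 0 ∧ ∀ b ∈ J, a * b = 0)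

include hcoh hR

/-- Functionals on a finitely generated reflexive submodule of a finite free module extend. -/
lemma dualMap_surjective_of_injective_of_free {K F : Type*} [AddCommGroup K] [Module R K]
    [AddCommGroup F] [Module R F] [Module.Finite R K] [IsReflexive R K] [Module.Finite R F]
    [Module.Free R F] (i : K →ₗ[R] F) (hi : Injective i) : Surjective i.dualMap := by
  have := (isPseudoCoherent_of_free hcoh F).finitePresentation i hi
  have := finitePresentation_dual hcoh K
  let N := LinearMap.range i.dualMap
  have hN : N.FG := by
    change (LinearMap.range i.dualMap).FG
    rw [← Submodule.map_top]
    exact Module.Finite.fg_top.map _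
  have : FinitePresentation R (Dual R K ⧸ N) :=
    finitePresentation_of_surjective N.mkQ N.mkQ_surjective (by rwa [Submodule.ker_mkQ])
  have hsub := subsingleton_of_subsingleton_dual hR (Dual R K ⧸ N) <| by
    refine subsingleton_of_forall_eq 0 fun θ ↦ ?_
    obtain ⟨k, hk⟩ := (bijective_dual_eval R K).surjective (θ ∘ₗ N.mkQ)
    have hik : i k = 0 := by
      rw [← (bijective_dual_eval R F).injective.eq_iff, map_zero]
      ext φ
      have hφ : N.mkQ (i.dualMap φ) = 0 := by simp [N]
      have := LinearMap.congr_fun hk (i.dualMap φ)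
      rw [LinearMap.comp_apply, hφ, map_zero] at this
      exact this
    obtain rfl : k = 0 := hi (hik.trans (map_zero i).symm)
    refine Submodule.linearMap_qext _ ?_
    rw [← hk, map_zero, LinearMap.zero_comp]
  exact LinearMap.range_eq_top.mp (Submodule.Quotient.subsingleton_iff.mp hsub)

/-- Over a coherent ring of depth zero, finitely presented modules of finite G-dimension are
totally reflexive. -/
lemma HasGDimLe.isTotallyReflexive {n : ℕ} {M : Type u} [AddCommGroup M] [Module R M]
    [FinitePresentation R M] (h : HasGDimLe R n M) : IsTotallyReflexive R M := by
  induction n generalizing M with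
  | zero => cases h with | zero h => exact h
  | succ n ih =>
    obtain ⟨k, p, hp⟩ := Module.Finite.exists_fin' R M
    have hK : (LinearMap.ker p).FG := FinitePresentation.fg_ker p hp
    have : Module.Finite R (LinearMap.ker p) := .of_fg hK
    have := isPseudoCoherent_pi hcoh k _ hK
    have hip := LinearMap.exact_subtype_ker_map p
    have hi := (LinearMap.ker p).subtype_injective
    have hKr := ih (h.syzygy hi hip hp)
    have := hKr.reflexive
    exact .right hi hip hp hKr isTotallyReflexive_of_projective
      (dualMap_surjective_of_injective_of_free hcoh hR _ hi)

end AB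

end Gorenstein

theorem zero_ideal_irreducible (R : Type u) [CommRing R] [IsLocalRing R]
    (hcoh : ∀ I : Ideal R, I.FG → Module.FinitePresentation R I)
    (hGor : ∀ I : Ideal R, I.FG → AB.GDim R (ModuleCat.of R I) ≠ ⊤)
    (hdepth : AB.depth R R = 0) :
    ∀ x y : R, Ideal.span {x} ⊓ Ideal.span {y} = ⊥ → x = 0 ∨ y = 0 := by
  intro x y hxy
  have hcoh' : AB.IsPseudoCoherent R R := hcoh
  have hann := fun J : Ideal R ↦ AB.exists_ne_zero_of_depth_eq_zero hdepth (J := J)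
  let I : Ideal R := Ideal.span {x} ⊔ Ideal.span {y}
  have hI : I.FG := (Submodule.fg_span_singleton x).sup (Submodule.fg_span_singleton y)
  have := hcoh I hI
  obtain ⟨n, hn⟩ := AB.exists_hasGDimLe_of_GDim_ne_top (hGor I hI)
  have hrefl := (hn.isTotallyReflexive hcoh' hann).reflexive
  have hext := AB.dualMap_surjective_of_injective_of_free hcoh' hann I.subtype I.subtype_injective
  have hx : x ∈ I := Ideal.mem_sup_left (Ideal.mem_span_singleton_self x)
  have hy : y ∈ I := Ideal.mem_sup_right (Ideal.mem_span_singleton_self y)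
  obtain ⟨φ, hφx, hφy⟩ : ∃ φ : I →ₗ[R] R, φ ⟨x, hx⟩ = x ∧ φ ⟨y, hy⟩ = 0 := by
    let f : R →ₗ.[R] R := ⟨Ideal.span {x}, (Ideal.span {x}).subtype⟩
    let g : R →ₗ.[R] R := ⟨Ideal.span {y}, 0⟩
    have hfg (a : f.domain) (b : g.domain) (hab : (a : R) = b) : f a = g b := by
      have h : (a : R) ∈ Ideal.span {y} := by rw [hab]; exact b.2
      exact (Submodule.mem_bot R).mp (hxy.le ⟨a.2, h⟩)
    exact ⟨(f.sup g hfg).toFun,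
      ((f.left_le_sup g hfg).2 (x := ⟨x, Ideal.mem_span_singleton_self x⟩) rfl).symm,
      ((f.right_le_sup g hfg).2 (x := ⟨y, Ideal.mem_span_singleton_self y⟩) rfl).symm⟩
  obtain ⟨ψ, rfl⟩ := hext φ
  have hψ (z : R) : ψ z = z * ψ 1 := by rw [← smul_eq_mul, ← map_smul, smul_eq_mul, mul_one]
  have h1 : x * ψ 1 = x := (hψ x).symm.trans hφx
  have h2 : y * ψ 1 = 0 := (hψ y).symm.trans hφy
  rcases IsLocalRing.isUnit_or_isUnit_one_sub_self (ψ 1) with h | h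
  · exact .inr (h.mul_left_eq_zero.mp h2)
  · exact .inl (h.mul_left_eq_zero.mp (by rw [mul_sub, h1, mul_one, sub_self]))
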